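/- Let k̂, β̂ ∈ ℝ with Δ = 18k̂β̂ + k̂² − 4 − 4k̂³β̂ − 27β̂² < 0, and let S be the unique real root of the cubic S³ + 27·4^{1/3}(3 − k̂²)S + 54(2k̂³ − 9k̂ + 27β̂) = 0. If 6k̂/4^{1/3} < S then β̂ < 0. -/

import Mathlib

/-- If a depressed cubic has a unique real root, then it is negative to the left of that root. -/
lemma depressed_cubic_neg_of_lt_unique_root {p q S x : ℝ} (hroot : S ^ 3 + p * S + q = 0)
    (huniq : ∀ y : ℝ, y ^ 3 + p * y + q = 0 → y = S) (hx : x < S) :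
    x ^ 3 + p * x + q < 0 := by
  by_contra! h
  have hfactor (y : ℝ) :
      y ^ 3 + p * y + q = (y - S) * (y ^ 2 + S * y + S ^ 2 + p) := by
    linear_combination hroot
  have hquad : x ^ 2 + S * x + S ^ 2 + p ≤ 0 := by
    rw [hfactor] at h
    by_contra! hpos
    exact absurd h (not_le.mpr (mul_neg_of_neg_of_pos (sub_neg.mpr hx) hpos))
  have hsq : (2 * x + S) ^ 2 ≤ -3 * S ^ 2 - 4 * p := by linarith
  have hD := Real.sq_sqrt ((sq_nonneg _).trans hsq)
  set r := √(-3 * S ^ 2 - 4 * p)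
  have h₁ : (-S + r) / 2 = S := huniq _ <| by
    rw [hfactor]
    linear_combination ((-S + r) / 2 - S) / 4 * hD
  have h₂ : (-S - r) / 2 = S := huniq _ <| by
    rw [hfactor]
    linear_combination ((-S - r) / 2 - S) / 4 * hD
  have hS : S = 0 := by linarith
  have hr : r = 0 := by linarith
  rw [← hD, hr, hS] at hsq
  nlinarith

theorem stmt_12 (k b S : ℝ)
    (hΔ : 18 * k * b + k ^ 2 - 4 - 4 * k ^ 3 * b - 27 * b ^ 2 < 0)
    (hroot : S ^ 3 + 27 * (4 : ℝ) ^ ((1 : ℝ) / 3) * (3 - k ^ 2) * S +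
      54 * (2 * k ^ 3 - 9 * k + 27 * b) = 0)
    (huniq : ∀ S' : ℝ, S' ^ 3 + 27 * (4 : ℝ) ^ ((1 : ℝ) / 3) * (3 - k ^ 2) * S' +
      54 * (2 * k ^ 3 - 9 * k + 27 * b) = 0 → S' = S)
    (hlt : 6 * k / (4 : ℝ) ^ ((1 : ℝ) / 3) < S) :
    b < 0 := by
  have hneg := depressed_cubic_neg_of_lt_unique_root hroot huniq hlt
  have hc : ((4 : ℝ) ^ ((1 : ℝ) / 3)) ^ 3 = 4 := by
    rw [← Real.rpow_natCast, ← Real.rpow_mul (by norm_num)]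
    norm_num
  have hc₀ : (4 : ℝ) ^ ((1 : ℝ) / 3) ≠ 0 := by positivity
  generalize (4 : ℝ) ^ ((1 : ℝ) / 3) = c at hneg hc hc₀
  have hcube : (6 * k / c) ^ 3 = 54 * k ^ 3 := by
    rw [div_pow, hc]
    ring
  have hlin : 27 * c * (3 - k ^ 2) * (6 * k / c) = 162 * k * (3 - k ^ 2) := by
    field_simp
    ring
  rw [hcube, hlin] at hneg
  linarith
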